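/- Let T be a triangle and define the local space 𝕏⁴_b(T) := P³(T) + P⁴_b(T), where P⁴_b(T) := P⁴(T) ∩ H¹₀(T) is the span of {λ_j λ₁λ₂λ₃ : j = 1,2,3} with λ_j the barycentric coordinates. Then 𝕏⁴_b(T) has dimension 12, and a function v ∈ 𝕏⁴_b(T) is uniquely determined by the 12 degrees of freedom: the vertex values v(x) for the 3 vertices x of T, the edge moments ∫_E v φ for φ ∈ P¹(E) for each of the 3 edges E (6 degrees), and the normal-derivative means ∫_E ∂_n v for each edge E (3 degrees). -/

import Mathlib

open scoped RealInnerProductSpace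

noncomputable section

/-- The Euclidean plane. -/
abbrev E2 := EuclideanSpace ℝ (Fin 2)

/-- Polynomials on `ℝ²` of total degree `≤ n`, as a subspace of functions
(`P^n(T)`; polynomial functions are determined by their values on the
nondegenerate triangle `T`). -/
def polyDeg (n : ℕ) : Submodule ℝ (E2 → ℝ) :=
  Submodule.span ℝ {f | ∃ i j : ℕ, i + j ≤ n ∧ f = fun p => p 0 ^ i * p 1 ^ j}

/-- The nodal family spanning `P³ + P⁴_b`: barycentric coordinates, two cubic functions per edge,
and the quartic bubbles. -/
def bubbleFamily (lam : Fin 3 → E2 → ℝ) (i : Fin 4 × Fin 3) : E2 → ℝ :=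
  ![lam i.2, lam (i.2 + 1) * lam (i.2 + 1) * lam (i.2 + 2),
    lam (i.2 + 1) * lam (i.2 + 2) * lam (i.2 + 2),
    lam i.2 * (lam 0 * lam 1 * lam 2)] i.1

lemma polyDeg_mul_le (m n : ℕ) : polyDeg m * polyDeg n ≤ polyDeg (m + n) := by
  unfold polyDeg
  rw [Submodule.span_mul_span, Submodule.span_le]
  rintro _ ⟨_, ⟨i, j, hij, rfl⟩, _, ⟨k, l, hkl, rfl⟩, rfl⟩
  refine Submodule.subset_span ⟨i + k, j + l, by omega, ?_⟩
  funext p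
  simp only [Pi.mul_apply]
  ring

lemma polyDeg_mono {m n : ℕ} (h : m ≤ n) : polyDeg m ≤ polyDeg n := by
  refine Submodule.span_mono ?_
  rintro _ ⟨i, j, hij, rfl⟩
  exact ⟨i, j, hij.trans h, rfl⟩

lemma affine_mem_polyDeg_one (a : E2) (b : ℝ) : (fun p : E2 => ⟪a, p⟫ + b) ∈ polyDeg 1 := by
  have h0 : (fun p : E2 => p 0 ^ 1 * p 1 ^ 0) ∈ polyDeg 1 :=
    Submodule.subset_span ⟨1, 0, by norm_num, rfl⟩
  have h1 : (fun p : E2 => p 0 ^ 0 * p 1 ^ 1) ∈ polyDeg 1 :=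
    Submodule.subset_span ⟨0, 1, by norm_num, rfl⟩
  have h2 : (fun p : E2 => p 0 ^ 0 * p 1 ^ 0) ∈ polyDeg 1 :=
    Submodule.subset_span ⟨0, 0, by norm_num, rfl⟩
  convert add_mem (add_mem (Submodule.smul_mem _ (a 0) h0) (Submodule.smul_mem _ (a 1) h1))
    (Submodule.smul_mem _ b h2) using 1
  funext p
  simp [PiLp.inner_apply, Fin.sum_univ_two]
  ring

/-- Nodal affine functions are the barycentric coordinates: they sum to one and reproduce points. -/
lemma sum_lam_eq_one_and_reproduce
    {x : Fin 3 → E2} (hx : AffineIndependent ℝ x) {lam : Fin 3 → E2 → ℝ}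
    (hlam_aff : ∀ j, ∃ (a : E2) (b : ℝ), lam j = fun p => ⟪a, p⟫ + b)
    (hlam_nodal : ∀ i j, lam j (x i) = if i = j then (1:ℝ) else 0) (p : E2) :
    ∑ k, lam k p = 1 ∧ ∑ k, lam k p • x k = p := by
  have htop : affineSpan ℝ (Set.range x) = ⊤ := by
    rw [hx.affineSpan_eq_top_iff_card_eq_finrank_add_one]
    simp
  let B : AffineBasis (Fin 3) ℝ E2 := ⟨x, hx, htop⟩
  have hsum : ∑ k, B.coord k p = 1 := B.sum_coord_apply_eq_one p
  have hrep : ∑ k, B.coord k p • x k = p := B.linear_combination_coord_eq_self p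
  have hlam : ∀ j, lam j p = B.coord j p := by
    intro j
    obtain ⟨a, b, hab⟩ := hlam_aff j
    have hval : ∀ i, ⟪a, x i⟫ = (if i = j then (1:ℝ) else 0) - b := by
      intro i
      have := hlam_nodal i j
      rw [hab] at this
      linarith
    rw [hab]
    show ⟪a, p⟫ + b = _
    conv_lhs => rw [← hrep]
    simp only [inner_sum, inner_smul_right, hval, mul_sub, Finset.sum_sub_distrib, ← Finset.sum_mul,
      hsum]
    simp
  simp only [hlam]
  exact ⟨hsum, hrep⟩

lemma triple_product_mem_span {lam : Fin 3 → E2 → ℝ} (hsum : ∀ p, ∑ k, lam k p = 1)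
    (i j k : Fin 3) :
    lam i * lam j * lam k ∈ Submodule.span ℝ (Set.range (bubbleFamily lam)) := by
  set W := Submodule.span ℝ (Set.range (bubbleFamily lam))
  have hF : ∀ i, bubbleFamily lam i ∈ W := fun i => Submodule.subset_span ⟨i, rfl⟩
  have hone : lam 0 + lam 1 + lam 2 = 1 := by
    funext p
    simpa [Fin.sum_univ_three] using hsum p
  have hb : lam 0 * lam 1 * lam 2 ∈ W := by
    have h := add_mem (add_mem (hF (3, 0)) (hF (3, 1))) (hF (3, 2))
    simp only [bubbleFamily, Matrix.cons_val] at h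
    convert h using 1
    linear_combination (-(lam 0 * lam 1 * lam 2)) * hone
  have hB : ∀ k, lam (k + 1) * lam (k + 1) * lam (k + 2) ∈ W := fun k => hF (1, k)
  have hC : ∀ k, lam (k + 1) * lam (k + 2) * lam (k + 2) ∈ W := fun k => hF (2, k)
  have h001 : lam 0 * lam 0 * lam 1 ∈ W := hB 2
  have h011 : lam 0 * lam 1 * lam 1 ∈ W := hC 2
  have h112 : lam 1 * lam 1 * lam 2 ∈ W := hB 0
  have h122 : lam 1 * lam 2 * lam 2 ∈ W := hC 0
  have h220 : lam 2 * lam 2 * lam 0 ∈ W := hB 1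
  have h200 : lam 2 * lam 0 * lam 0 ∈ W := hC 1
  have hl : ∀ k, lam k ∈ W := fun k => hF (0, k)
  -- `λ_a = λ_a (λ_0 + λ_1 + λ_2)²` isolates the cube.
  have hcube : ∀ a b c : Fin 3, lam a + lam b + lam c = 1 → lam a * lam a * lam b ∈ W →
      lam a * lam b * lam b ∈ W → lam a * lam a * lam c ∈ W → lam a * lam c * lam c ∈ W →
      lam a * lam b * lam c ∈ W → lam a * lam a * lam a ∈ W := by
    intro a b c h h1 h2 h3 h4 h5
    have := sub_mem (sub_mem (sub_mem (sub_mem (sub_mem (hl a) (add_mem h1 h1)) h2)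
      (add_mem h3 h3)) h4) (add_mem h5 h5)
    convert this using 1
    linear_combination (lam a * (lam a + lam b + lam c + 1)) * h
  have hcongr : ∀ {f g : E2 → ℝ}, f ∈ W → g = f → g ∈ W := fun h e => e ▸ h
  have h000 : lam 0 * lam 0 * lam 0 ∈ W :=
    hcube 0 1 2 hone h001 h011 (hcongr h200 (by ring)) (hcongr h220 (by ring)) hb
  have h111 : lam 1 * lam 1 * lam 1 ∈ W :=
    hcube 1 2 0 (by rw [← hone]; ring) h112 h122 (hcongr h011 (by ring)) (hcongr h001 (by ring))
      (hcongr hb (by ring))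
  have h222 : lam 2 * lam 2 * lam 2 ∈ W :=
    hcube 2 0 1 (by rw [← hone]; ring) h220 (hcongr h200 (by ring)) (hcongr h122 (by ring))
      (hcongr h112 (by ring)) (hcongr hb (by ring))
  have hsq : ∀ a b, lam a * lam a * lam b ∈ W := by
    intro a b
    fin_cases a <;> fin_cases b
    exacts [h000, h001, hcongr h200 (by dsimp; ring), hcongr h011 (by dsimp; ring), h111, h112,
      h220, hcongr h122 (by dsimp; ring), h222]
  by_cases hij : i = j
  · exact hij ▸ hsq i k
  by_cases hik : i = k
  · exact hcongr (hsq i j) (by rw [← hik]; ring)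
  by_cases hjk : j = k
  · exact hcongr (hsq j i) (by rw [← hjk]; ring)
  refine hcongr hb ?_
  have huniv : ({i, j, k} : Finset (Fin 3)) = Finset.univ := by
    apply Finset.eq_univ_of_card
    rw [Finset.card_eq_three.2 ⟨i, j, k, hij, hik, hjk, rfl⟩, Fintype.card_fin]
  have h := Fin.prod_univ_three lam
  rw [← huniv, Finset.prod_insert (by simp [hij, hik]), Finset.prod_pair hjk] at h
  rw [← h, mul_assoc]

lemma span_bubbleFamily
    {x : Fin 3 → E2} {lam : Fin 3 → E2 → ℝ}
    (hlam_aff : ∀ j, ∃ (a : E2) (b : ℝ), lam j = fun p => ⟪a, p⟫ + b)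
    (hsum : ∀ p, ∑ k, lam k p = 1) (hrep : ∀ p, ∑ k, lam k p • x k = p) :
    polyDeg 3 ⊔ Submodule.span ℝ
        {f | ∃ j : Fin 3, f = fun p => lam j p * (lam 0 p * lam 1 p * lam 2 p)}
      = Submodule.span ℝ (Set.range (bubbleFamily lam)) := by
  have hdeg : ∀ j, lam j ∈ polyDeg 1 := by
    intro j
    obtain ⟨a, b, hab⟩ := hlam_aff j
    rw [hab]
    exact affine_mem_polyDeg_one a b
  have hprod : ∀ i j k, lam i * lam j * lam k ∈ polyDeg 3 := fun i j k =>
    polyDeg_mul_le 2 1 (Submodule.mul_mem_mul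
      (polyDeg_mul_le 1 1 (Submodule.mul_mem_mul (hdeg i) (hdeg j))) (hdeg k))
  apply le_antisymm
  · refine sup_le ?_ ?_
    · let L : Submodule ℝ (E2 → ℝ) := Submodule.span ℝ (Set.range lam)
      have hL : ∀ k, lam k ∈ L := fun k => Submodule.subset_span ⟨k, rfl⟩
      have hone : (1 : E2 → ℝ) ∈ L := by
        have h : ∑ k, lam k ∈ L := Submodule.sum_mem _ fun k _ => hL k
        convert h using 1
        funext p
        simp [hsum p]
      have hcoord : ∀ m : Fin 2, (fun p : E2 => p m) ∈ L := by
        intro m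
        have h : ∑ k, x k m • lam k ∈ L :=
          Submodule.sum_mem _ fun k _ => Submodule.smul_mem _ _ (hL k)
        convert h using 1
        funext p
        conv_lhs => rw [← hrep p]
        simp [Fin.sum_univ_three, mul_comm]
      have hcube : L ^ 3 ≤ Submodule.span ℝ (Set.range (bubbleFamily lam)) := by
        rw [pow_succ, pow_two, Submodule.span_mul_span, Submodule.span_mul_span, Submodule.span_le]
        rintro _ ⟨_, ⟨_, ⟨i, rfl⟩, _, ⟨j, rfl⟩, rfl⟩, _, ⟨k, rfl⟩, rfl⟩
        exact triple_product_mem_span hsum i j k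
      refine le_trans ?_ hcube
      unfold polyDeg
      rw [Submodule.span_le]
      rintro _ ⟨i, j, hij, rfl⟩
      have hpow : L ^ (i + j) ≤ L ^ 3 :=
        pow_le_pow_right' (Submodule.one_le.2 hone) hij
      apply hpow
      rw [pow_add]
      exact Submodule.mul_mem_mul (Submodule.pow_mem_pow _ (hcoord 0) i)
        (Submodule.pow_mem_pow _ (hcoord 1) j)
    · rw [Submodule.span_le]
      rintro _ ⟨j, rfl⟩
      exact Submodule.subset_span ⟨(3, j), rfl⟩
  · rw [Submodule.span_le]
    rintro _ ⟨⟨m, k⟩, rfl⟩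
    fin_cases m
    · exact Submodule.mem_sup_left (polyDeg_mono (by norm_num) (hdeg k))
    · exact Submodule.mem_sup_left (hprod _ _ _)
    · exact Submodule.mem_sup_left (hprod _ _ _)
    · exact Submodule.mem_sup_right (Submodule.subset_span ⟨k, rfl⟩)

lemma eq_zero_of_inner_eq_zero {a d n : E2} (hn : n ≠ 0) (hd : d ≠ 0)
    (hnd : ⟪n, d⟫ = 0) (had : ⟪a, d⟫ = 0) (han : ⟪a, n⟫ = 0) : a = 0 := by
  have hn' : 0 < ⟪n, n⟫ := real_inner_self_pos.2 hn
  have hd' : 0 < ⟪d, d⟫ := real_inner_self_pos.2 hd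
  simp only [PiLp.inner_apply, Fin.sum_univ_two, RCLike.inner_apply, conj_trivial] at *
  have hdet : n 0 * d 1 - n 1 * d 0 ≠ 0 := by
    intro h
    have : (n 0 * n 0 + n 1 * n 1) * (d 0 * d 0 + d 1 * d 1) = 0 := by
      linear_combination (d 0 * n 0 + d 1 * n 1) * hnd + (n 0 * d 1 - n 1 * d 0) * h
    exact (mul_pos hn' hd').ne' this
  ext i
  fin_cases i
  · refine (mul_eq_zero.1 (?_ : (n 0 * d 1 - n 1 * d 0) * a 0 = 0)).resolve_left hdet
    linear_combination d 1 * han - n 1 * had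
  · refine (mul_eq_zero.1 (?_ : (n 0 * d 1 - n 1 * d 0) * a 1 = 0)).resolve_left hdet
    linear_combination n 0 * had - d 0 * han

lemma integral_edge_cubic (a b : ℝ) :
    ∫ t in (0:ℝ)..1, (a * (1 - t) + b * t) * ((1 - t) * t) = (a + b) / 12 := by
  have : ∀ t : ℝ, (a * (1 - t) + b * t) * ((1 - t) * t)
      = a * t ^ 1 + (b - 2 * a) * t ^ 2 + (a - b) * t ^ 3 := fun t => by ring
  simp only [this]
  rw [intervalIntegral.integral_add, intervalIntegral.integral_add]
  · simp only [intervalIntegral.integral_const_mul, integral_pow]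
    norm_num
    ring
  all_goals exact Continuous.intervalIntegrable (by fun_prop) _ _

lemma integral_mul_edge_cubic (a b : ℝ) :
    ∫ t in (0:ℝ)..1, t * ((a * (1 - t) + b * t) * ((1 - t) * t)) = a / 30 + b / 20 := by
  have : ∀ t : ℝ, t * ((a * (1 - t) + b * t) * ((1 - t) * t))
      = a * t ^ 2 + (b - 2 * a) * t ^ 3 + (a - b) * t ^ 4 := fun t => by ring
  simp only [this]
  rw [intervalIntegral.integral_add, intervalIntegral.integral_add]
  · simp only [intervalIntegral.integral_const_mul, integral_pow]
    norm_num
    ring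
  all_goals exact Continuous.intervalIntegrable (by fun_prop) _ _

lemma lam_edge {x : Fin 3 → E2} {lam : Fin 3 → E2 → ℝ}
    (hlam_aff : ∀ j, ∃ (a : E2) (b : ℝ), lam j = fun p => ⟪a, p⟫ + b)
    (hlam_nodal : ∀ i j, lam j (x i) = if i = j then (1:ℝ) else 0) (i i' j : Fin 3) (t : ℝ) :
    lam j (x i + t • (x i' - x i)) =
      (1 - t) * (if i = j then 1 else 0) + t * (if i' = j then 1 else 0) := by
  rw [← hlam_nodal i j, ← hlam_nodal i' j]
  obtain ⟨a, b, hab⟩ := hlam_aff j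
  rw [hab]
  simp only [inner_add_right, inner_smul_right, inner_sub_right]
  ring

/-- The degrees of freedom determine the coefficients with respect to `bubbleFamily`. -/
lemma bubbleFamily_coeff_eq_zero
    {x : Fin 3 → E2} (hx : AffineIndependent ℝ x) {lam : Fin 3 → E2 → ℝ}
    (hlam_aff : ∀ j, ∃ (a : E2) (b : ℝ), lam j = fun p => ⟪a, p⟫ + b)
    (hlam_nodal : ∀ i j, lam j (x i) = if i = j then (1:ℝ) else 0)
    {n : Fin 3 → E2} (hn : ∀ k, n k ≠ 0 ∧ ⟪n k, x (k+2) - x (k+1)⟫ = 0)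
    (c : Fin 4 × Fin 3 → ℝ) {v : E2 → ℝ} (hv : ∑ i, c i • bubbleFamily lam i = v)
    (hvert : ∀ i, v (x i) = 0)
    (hmom0 : ∀ k : Fin 3,
      (∫ t in (0:ℝ)..1, v (x (k+1) + t • (x (k+2) - x (k+1)))) = 0)
    (hmom1 : ∀ k : Fin 3,
      (∫ t in (0:ℝ)..1, t * v (x (k+1) + t • (x (k+2) - x (k+1)))) = 0)
    (hnormal : ∀ k : Fin 3,
      (∫ t in (0:ℝ)..1, fderiv ℝ v (x (k+1) + t • (x (k+2) - x (k+1))) (n k)) = 0) :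
    ∀ i, c i = 0 := by
  have hedge := lam_edge hlam_aff hlam_nodal
  have hv' : ∀ p, v p = ∑ k, (c (0, k) * lam k p
      + c (1, k) * (lam (k + 1) p * lam (k + 1) p * lam (k + 2) p)
      + c (2, k) * (lam (k + 1) p * lam (k + 2) p * lam (k + 2) p)
      + c (3, k) * (lam k p * (lam 0 p * lam 1 p * lam 2 p))) := by
    intro p
    rw [← hv]
    simp only [Fintype.sum_prod_type, Fin.sum_univ_four, Finset.sum_apply, Pi.smul_apply, smul_eq_mul, bubbleFamily, Matrix.cons_val, Pi.mul_apply,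
      Finset.sum_add_distrib]
  have h0 : ∀ k, c (0, k) = 0 := by
    intro k
    have h := hvert k
    rw [hv'] at h
    fin_cases k <;> simpa [Fin.sum_univ_three, hlam_nodal] using h
  have hvedge : ∀ (k : Fin 3) (t : ℝ), v (x (k+1) + t • (x (k+2) - x (k+1))) =
      (c (1, k) * (1 - t) + c (2, k) * t) * ((1 - t) * t) := by
    intro k t
    rw [hv']
    simp only [Fin.sum_univ_three, hedge, h0]
    fin_cases k <;> simp <;> ring
  have h12 : ∀ k, c (1, k) = 0 ∧ c (2, k) = 0 := by
    intro k
    have hm0 := hmom0 k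
    have hm1 := hmom1 k
    simp only [hvedge, integral_edge_cubic, integral_mul_edge_cubic] at hm0 hm1
    constructor <;> linarith
  choose a b hab using hlam_aff
  have hgrad : ∀ j p, HasFDerivAt (lam j) (innerSL ℝ (a j)) p := by
    intro j p
    rw [hab]
    exact ((innerSL ℝ (a j)).hasFDerivAt).add_const _
  have hvb : v = fun p => ((c (3, 0) * lam 0 p + c (3, 1) * lam 1 p) + c (3, 2) * lam 2 p)
      * ((lam 0 p * lam 1 p) * lam 2 p) := by
    funext p
    rw [hv']
    simp only [Fin.sum_univ_three, h0, (h12 _).1, (h12 _).2]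
    ring
  have hdv : ∀ (k : Fin 3) (t : ℝ), fderiv ℝ v (x (k+1) + t • (x (k+2) - x (k+1))) (n k) =
      ⟪a k, n k⟫ * ((c (3, k + 1) * (1 - t) + c (3, k + 2) * t) * ((1 - t) * t)) := by
    intro k t
    set p := x (k+1) + t • (x (k+2) - x (k+1)) with hp
    have hd := (((((hgrad 0 p).const_mul (c (3, 0))).add ((hgrad 1 p).const_mul (c (3, 1)))).add
      ((hgrad 2 p).const_mul (c (3, 2)))).mul (((hgrad 0 p).mul (hgrad 1 p)).mul (hgrad 2 p)))
    rw [(hd.congr_of_eventuallyEq (f₁ := v) (.of_eq hvb)).fderiv]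
    simp only [hp, Pi.add_apply, Pi.mul_apply, add_apply,
      smul_apply, smul_eq_mul, innerSL_apply_apply, hedge]
    fin_cases k <;> simp <;> ring
  have hanz : ∀ k, ⟪a k, n k⟫ ≠ 0 := by
    intro k han
    have hval : ∀ i, ⟪a k, x i⟫ + b k = if i = k then (1:ℝ) else 0 := by
      intro i
      rw [← hlam_nodal i k, hab]
    have hk1 : k + 1 ≠ k := by fin_cases k <;> decide
    have hk2 : k + 2 ≠ k := by fin_cases k <;> decide
    have hk12 : k + 2 ≠ k + 1 := by fin_cases k <;> decide
    have e0 := hval k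
    have e1 := hval (k + 1)
    have e2 := hval (k + 2)
    rw [if_pos rfl] at e0
    rw [if_neg hk1] at e1
    rw [if_neg hk2] at e2
    have ha : a k = 0 := eq_zero_of_inner_eq_zero (hn k).1
      (sub_ne_zero.2 fun h => hk12 (hx.injective h)) (hn k).2
      (by rw [inner_sub_right]; linarith) han
    rw [ha, inner_zero_left] at e0 e1
    linarith
  have hadd : ∀ k, c (3, k + 1) + c (3, k + 2) = 0 := by
    intro k
    have h := hnormal k
    simp only [hdv, intervalIntegral.integral_const_mul, integral_edge_cubic] at h
    have := (mul_eq_zero.1 h).resolve_left (hanz k)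
    linarith
  have e0 : c (3, 1) + c (3, 2) = 0 := hadd 0
  have e1 : c (3, 2) + c (3, 0) = 0 := hadd 1
  have e2 : c (3, 0) + c (3, 1) = 0 := hadd 2
  rintro ⟨m, k⟩
  fin_cases m
  · exact h0 k
  · exact (h12 k).1
  · exact (h12 k).2
  · fin_cases k <;> dsimp <;> linarith

/- STATEMENT 9 (Lemma 3.10: dimension and unisolvence of the local space
`𝕏⁴_b(T) = P³(T) + P⁴_b(T)`).
`T` is the nondegenerate triangle with vertices `x 0, x 1, x 2`;
`lam j` are the barycentric coordinates (affine functions with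
`lam j (x i) = δ_ij`), so that `P⁴_b(T) = P⁴(T) ∩ H¹₀(T)` is the span of the
bubbles `λ_j·λ₁λ₂λ₃`, `j = 1,2,3`.  The edge `E_k` opposite the vertex `x k`
is parametrized by `t ↦ x (k+1) + t•(x (k+2) − x (k+1))`, `t ∈ [0,1]`, and
`n k` is a (nonzero) normal vector of `E_k`; edge integrals are written as
interval integrals in the parameter (the constant length factor `|E_k|` is
irrelevant for the vanishing of a degree of freedom).
Conclusions: `dim 𝕏⁴_b(T) = 12`, and the 12 degrees of freedom — the 3 vertex
values `v(x)`, the 6 edge moments `∫_E v·φ` with `φ ∈ P¹(E)` (tested against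
the basis `1, t` of `P¹(E_k)`), and the 3 normal-derivative means
`∫_E ∂_n v` — determine `v ∈ 𝕏⁴_b(T)` uniquely (i.e. they are unisolvent). -/
theorem X4b_dim_and_unisolvence
    (x : Fin 3 → E2) (hx : AffineIndependent ℝ x)
    (lam : Fin 3 → E2 → ℝ)
    (hlam_aff : ∀ j, ∃ (a : E2) (b : ℝ), lam j = fun p => ⟪a, p⟫ + b)
    (hlam_nodal : ∀ i j, lam j (x i) = if i = j then (1:ℝ) else 0)
    (n : Fin 3 → E2)
    (hn : ∀ k, n k ≠ 0 ∧ ⟪n k, x (k+2) - x (k+1)⟫ = 0) :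
    Module.finrank ℝ
      ↥(polyDeg 3 ⊔ Submodule.span ℝ
          {f | ∃ j : Fin 3, f = fun p => lam j p * (lam 0 p * lam 1 p * lam 2 p)})
      = 12 ∧
    ∀ v ∈ polyDeg 3 ⊔ Submodule.span ℝ
        {f | ∃ j : Fin 3, f = fun p => lam j p * (lam 0 p * lam 1 p * lam 2 p)},
      (∀ i, v (x i) = 0) →
      (∀ k : Fin 3,
        (∫ t in (0:ℝ)..1, v (x (k+1) + t • (x (k+2) - x (k+1)))) = 0) →
      (∀ k : Fin 3,
        (∫ t in (0:ℝ)..1, t * v (x (k+1) + t • (x (k+2) - x (k+1)))) = 0) →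
      (∀ k : Fin 3,
        (∫ t in (0:ℝ)..1,
          fderiv ℝ v (x (k+1) + t • (x (k+2) - x (k+1))) (n k)) = 0) →
      v = 0 := by
  have hbary := sum_lam_eq_one_and_reproduce hx hlam_aff hlam_nodal
  rw [span_bubbleFamily hlam_aff (fun p => (hbary p).1) (fun p => (hbary p).2)]
  constructor
  · have hli : LinearIndependent ℝ (bubbleFamily lam) := by
      rw [Fintype.linearIndependent_iff]
      intro c hc
      exact bubbleFamily_coeff_eq_zero hx hlam_aff hlam_nodal hn c hc (by simp) (by simp)
        (by simp) (by simp)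
    rw [finrank_span_eq_card hli]
    simp
  · intro v hv hvert hmom0 hmom1 hnormal
    obtain ⟨c, hc⟩ := (Submodule.mem_span_range_iff_exists_fun ℝ).1 hv
    have hzero := bubbleFamily_coeff_eq_zero hx hlam_aff hlam_nodal hn c hc hvert hmom0 hmom1
      hnormal
    rw [← hc]
    simp [hzero]

end
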